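/- arXiv:2507.02552 — 2 statements merged into one kernel-verified Lean document; each statement's English description precedes it below -/
import Mathlib

section
/- Drift increment identity for the quadratic scanning statistic, right case (Lemma B.7/lem:f, second identity). Let n, m, k, θ be integers with 1 ≤ θ ≤ k ≤ m ≤ n − 1, let Σ be a p×p real symmetric matrix, and let β₀, β₁ ∈ ℝ^p with δ = β₁ − β₀. Then f_k − f_m = ( (m−k)·θ / (k·m) ) · ( θ·‖Σδ‖₂² + ‖Σβ₀‖₂² − ‖Σβ₁‖₂² ). -/
open Matrix

/-- Squared Euclidean (ℓ₂) norm of a vector in `ℝ^p`. -/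
def sqnorm2 {p : ℕ} (v : Fin p → ℝ) : ℝ := ∑ i, v i ^ 2

/-- The drift of the quadratic covariance-scanning statistic:
`f_k = (k(n−k)/n)·[ ((n−θ)²/(n−k)²·𝟙{k ≤ θ} + θ²/k²·𝟙{k > θ})·δᵀΣ²δ
  − ((θ−k)/(n−k)²·𝟙{k ≤ θ} − (k−θ)/k²·𝟙{k > θ})·δᵀΣ²(β₀+β₁)
  + (1/k)·β₀ᵀΣ²β₀ + (1/(n−k))·β₁ᵀΣ²β₁ ]`. -/
noncomputable def fdrift {p : ℕ} (n θ : ℕ) (S : Matrix (Fin p) (Fin p) ℝ)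
    (β₀ β₁ : Fin p → ℝ) (k : ℕ) : ℝ :=
  ((k : ℝ) * ((n : ℝ) - k) / n) *
    (((if k ≤ θ then ((n : ℝ) - θ) ^ 2 / ((n : ℝ) - k) ^ 2 else 0) +
        (if θ < k then (θ : ℝ) ^ 2 / (k : ℝ) ^ 2 else 0)) *
        ((β₁ - β₀) ⬝ᵥ (S * S).mulVec (β₁ - β₀))
      - ((if k ≤ θ then ((θ : ℝ) - k) / ((n : ℝ) - k) ^ 2 else 0) -
          (if θ < k then ((k : ℝ) - θ) / (k : ℝ) ^ 2 else 0)) *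
          ((β₁ - β₀) ⬝ᵥ (S * S).mulVec (β₀ + β₁))
      + (1 / (k : ℝ)) * (β₀ ⬝ᵥ (S * S).mulVec β₀)
      + (1 / ((n : ℝ) - k)) * (β₁ ⬝ᵥ (S * S).mulVec β₁))


theorem dotProduct_mul_self_mulVec_of_isSymm {p : ℕ} {S : Matrix (Fin p) (Fin p) ℝ}
    (hS : S.IsSymm) (u v : Fin p → ℝ) :
    u ⬝ᵥ (S * S).mulVec v = S.mulVec u ⬝ᵥ S.mulVec v := by
  rw [← Matrix.mulVec_mulVec, Matrix.dotProduct_mulVec, ← Matrix.mulVec_transpose, hS.eq]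

theorem sqnorm2_eq_dotProduct {p : ℕ} (v : Fin p → ℝ) : sqnorm2 v = v ⬝ᵥ v := by
  simp [sqnorm2, dotProduct, sq]

theorem sub_dotProduct_mul_self_mulVec_add {p : ℕ} {S : Matrix (Fin p) (Fin p) ℝ}
    (hS : S.IsSymm) (u v : Fin p → ℝ) :
    (v - u) ⬝ᵥ (S * S).mulVec (u + v) = sqnorm2 (S.mulVec v) - sqnorm2 (S.mulVec u) := by
  rw [dotProduct_mul_self_mulVec_of_isSymm hS, sqnorm2_eq_dotProduct, sqnorm2_eq_dotProduct,
    Matrix.mulVec_sub, Matrix.mulVec_add, sub_dotProduct, dotProduct_add, dotProduct_add,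
    dotProduct_comm (S.mulVec v) (S.mulVec u)]
  ring

/-- Closed form of the drift to the right of the change point. -/
theorem fdrift_eq_of_le {p n θ k : ℕ} {S : Matrix (Fin p) (Fin p) ℝ} (hS : S.IsSymm)
    (β₀ β₁ : Fin p → ℝ) (hθ : 1 ≤ θ) (hθk : θ ≤ k) (hk : k < n) :
    fdrift n θ S β₀ β₁ k
      = (1 / (k : ℝ) - 1 / n) * θ * (θ * sqnorm2 (S.mulVec (β₁ - β₀))
          + sqnorm2 (S.mulVec β₀) - sqnorm2 (S.mulVec β₁)) + sqnorm2 (S.mulVec β₁) := by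
  have hk0 : (k : ℝ) ≠ 0 := Nat.cast_ne_zero.mpr (by lia)
  have hn0 : (n : ℝ) ≠ 0 := Nat.cast_ne_zero.mpr (by lia)
  have hnk : (n : ℝ) - k ≠ 0 := sub_ne_zero.mpr (Nat.cast_lt.mpr hk).ne'
  rw [fdrift, sub_dotProduct_mul_self_mulVec_add hS]
  simp only [dotProduct_mul_self_mulVec_of_isSymm hS, ← sqnorm2_eq_dotProduct]
  rcases hθk.eq_or_lt with rfl | h
  · simp only [le_refl, lt_irrefl, if_true, if_false]
    field_simp
    ring
  · simp only [h, h.not_ge, if_true, if_false]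
    field_simp
    ring

/-- Drift increment identity for the quadratic scanning statistic, right case:
for `1 ≤ θ ≤ k ≤ m ≤ n−1` and symmetric `Σ`,
`f_k − f_m = ((m−k)θ/(km))·(θ‖Σδ‖₂² + ‖Σβ₀‖₂² − ‖Σβ₁‖₂²)`. -/
theorem fdrift_increment_right (p n m k θ : ℕ) (S : Matrix (Fin p) (Fin p) ℝ)
    (hS : S.IsSymm) (β₀ β₁ : Fin p → ℝ)
    (hθ : 1 ≤ θ) (hθk : θ ≤ k) (hkm : k ≤ m) (hm : m ≤ n - 1) :
    fdrift n θ S β₀ β₁ k - fdrift n θ S β₀ β₁ m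
      = ((m : ℝ) - k) * (θ : ℝ) / ((k : ℝ) * (m : ℝ)) *
          ((θ : ℝ) * sqnorm2 (S.mulVec (β₁ - β₀))
            + sqnorm2 (S.mulVec β₀) - sqnorm2 (S.mulVec β₁)) := by
  have hk0 : (k : ℝ) ≠ 0 := Nat.cast_ne_zero.mpr (by lia)
  have hm0 : (m : ℝ) ≠ 0 := Nat.cast_ne_zero.mpr (by lia)
  rw [fdrift_eq_of_le hS β₀ β₁ hθ hθk (by lia),
    fdrift_eq_of_le hS β₀ β₁ hθ (hθk.trans hkm) (by lia)]
  field_simp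
  ring
end

section
/- Drift increment lower bound for the quadratic scanning statistic (Lemma B.7/lem:f, inequality part). Let n, θ be integers with 1 ≤ θ ≤ n, let Σ be a p×p real symmetric matrix, and let β₀, β₁ ∈ ℝ^p with δ = β₁ − β₀. Assume 2·‖Σβ₀‖₂² ≤ (n−θ)·‖Σδ‖₂² and 2·‖Σβ₁‖₂² ≤ θ·‖Σδ‖₂². Then: (a) for all integers m, k with 1 ≤ m ≤ k ≤ θ ≤ n and k ≤ n−1, f_k − f_m ≥ ( ‖Σδ‖₂²·(k−m)/2 ) · (n−θ)² / ((n−k)·(n−m)); and (b) for all integers m, k with 1 ≤ θ ≤ k ≤ m ≤ n−1, f_k − f_m ≥ ( ‖Σδ‖₂²·(m−k)/2 ) · θ² / (k·m). -/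
open Matrix

theorem sqnorm2_nonneg {p : ℕ} (v : Fin p → ℝ) : 0 ≤ sqnorm2 v :=
  Finset.sum_nonneg fun _ _ => sq_nonneg _

theorem Matrix.IsSymm.dotProduct_mul_self_mulVec {p : ℕ} {S : Matrix (Fin p) (Fin p) ℝ}
    (hS : S.IsSymm) (v w : Fin p → ℝ) :
    v ⬝ᵥ (S * S).mulVec w = S.mulVec v ⬝ᵥ S.mulVec w := by
  rw [← mulVec_mulVec, dotProduct_mulVec, ← mulVec_transpose, hS.eq]

theorem dotProduct_mul_self_mulVec_self {p : ℕ} {S : Matrix (Fin p) (Fin p) ℝ}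
    (hS : S.IsSymm) (v : Fin p → ℝ) :
    v ⬝ᵥ (S * S).mulVec v = sqnorm2 (S.mulVec v) := by
  rw [hS.dotProduct_mul_self_mulVec, sqnorm2_eq_dotProduct]

theorem dotProduct_mul_self_mulVec_sub_add {p : ℕ} {S : Matrix (Fin p) (Fin p) ℝ}
    (hS : S.IsSymm) (v w : Fin p → ℝ) :
    (w - v) ⬝ᵥ (S * S).mulVec (v + w) =
      sqnorm2 (S.mulVec w) - sqnorm2 (S.mulVec v) := by
  rw [hS.dotProduct_mul_self_mulVec, sqnorm2_eq_dotProduct, sqnorm2_eq_dotProduct,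
    mulVec_sub, mulVec_add, sub_dotProduct, dotProduct_add, dotProduct_add,
    dotProduct_comm (S.mulVec v) (S.mulVec w)]
  ring

theorem fdrift_of_le {p n θ k : ℕ} {S : Matrix (Fin p) (Fin p) ℝ} (hS : S.IsSymm)
    (β₀ β₁ : Fin p → ℝ) (hk : 1 ≤ k) (hkθ : k ≤ θ) (hkn : k < n) :
    fdrift n θ S β₀ β₁ k = sqnorm2 (S.mulVec β₀) +
      ((n : ℝ) - θ) / n * ((k : ℝ) / ((n : ℝ) - k)) *
        (((n : ℝ) - θ) * sqnorm2 (S.mulVec (β₁ - β₀)) + sqnorm2 (S.mulVec β₁)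
          - sqnorm2 (S.mulVec β₀)) := by
  have hk0 : (k : ℝ) ≠ 0 := by positivity
  have hn0 : (n : ℝ) ≠ 0 := by
    have : 0 < n := by omega
    positivity
  have hnk : (n : ℝ) - k ≠ 0 := sub_ne_zero.2 (by exact_mod_cast hkn.ne')
  simp only [fdrift, if_pos hkθ, if_neg hkθ.not_gt, dotProduct_mul_self_mulVec_self hS,
    dotProduct_mul_self_mulVec_sub_add hS]
  field_simp
  ring

theorem fdrift_of_ge {p n θ k : ℕ} {S : Matrix (Fin p) (Fin p) ℝ} (hS : S.IsSymm)
    (β₀ β₁ : Fin p → ℝ) (hk : 1 ≤ k) (hkθ : θ ≤ k) (hkn : k < n) :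
    fdrift n θ S β₀ β₁ k = sqnorm2 (S.mulVec β₁) +
      (θ : ℝ) / n * (((n : ℝ) - k) / k) *
        ((θ : ℝ) * sqnorm2 (S.mulVec (β₁ - β₀)) + sqnorm2 (S.mulVec β₀)
          - sqnorm2 (S.mulVec β₁)) := by
  have hk0 : (k : ℝ) ≠ 0 := by positivity
  have hn0 : (n : ℝ) ≠ 0 := by
    have : 0 < n := by omega
    positivity
  have hnk : (n : ℝ) - k ≠ 0 := sub_ne_zero.2 (by exact_mod_cast hkn.ne')
  rcases hkθ.eq_or_lt with rfl | hlt
  · rw [fdrift_of_le hS β₀ β₁ hk le_rfl hkn]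
    field_simp
    ring
  · simp only [fdrift, if_pos hlt, if_neg hlt.not_ge, dotProduct_mul_self_mulVec_self hS,
      dotProduct_mul_self_mulVec_sub_add hS]
    field_simp
    ring

/-- Drift increment lower bound for the quadratic scanning statistic (Lemma B.7,
inequality part). Assuming `2‖Σβ₀‖₂² ≤ (n−θ)‖Σδ‖₂²` and `2‖Σβ₁‖₂² ≤ θ‖Σδ‖₂²`:
(a) for `1 ≤ m ≤ k ≤ θ ≤ n`, `k ≤ n−1`,
`f_k − f_m ≥ (‖Σδ‖₂²(k−m)/2)·(n−θ)²/((n−k)(n−m))`;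
(b) for `1 ≤ θ ≤ k ≤ m ≤ n−1`,
`f_k − f_m ≥ (‖Σδ‖₂²(m−k)/2)·θ²/(km)`. -/
theorem fdrift_increment_lower_bound (p n θ : ℕ) (hθ1 : 1 ≤ θ) (hθn : θ ≤ n)
    (S : Matrix (Fin p) (Fin p) ℝ) (hS : S.IsSymm) (β₀ β₁ : Fin p → ℝ)
    (h0 : 2 * sqnorm2 (S.mulVec β₀) ≤ ((n : ℝ) - θ) * sqnorm2 (S.mulVec (β₁ - β₀)))
    (h1 : 2 * sqnorm2 (S.mulVec β₁) ≤ (θ : ℝ) * sqnorm2 (S.mulVec (β₁ - β₀))) :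
    (∀ m k : ℕ, 1 ≤ m → m ≤ k → k ≤ θ → k ≤ n - 1 →
        sqnorm2 (S.mulVec (β₁ - β₀)) * ((k : ℝ) - m) / 2 *
            (((n : ℝ) - θ) ^ 2 / (((n : ℝ) - k) * ((n : ℝ) - m)))
          ≤ fdrift n θ S β₀ β₁ k - fdrift n θ S β₀ β₁ m) ∧
      (∀ m k : ℕ, θ ≤ k → k ≤ m → m ≤ n - 1 →
        sqnorm2 (S.mulVec (β₁ - β₀)) * ((m : ℝ) - k) / 2 *
            ((θ : ℝ) ^ 2 / ((k : ℝ) * (m : ℝ)))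
          ≤ fdrift n θ S β₀ β₁ k - fdrift n θ S β₀ β₁ m) := by
  have hA := sqnorm2_nonneg (S.mulVec β₀)
  have hB := sqnorm2_nonneg (S.mulVec β₁)
  have hθn' : (0 : ℝ) ≤ (n : ℝ) - θ := sub_nonneg.2 (by exact_mod_cast hθn)
  have hn0 : (n : ℝ) ≠ 0 := by
    have : 0 < n := by omega
    positivity
  refine ⟨fun m k hm hmk hkθ hkn => ?_, fun m k hθk hkm hmn => ?_⟩
  · have hmk' : (0 : ℝ) ≤ (k : ℝ) - m := sub_nonneg.2 (by exact_mod_cast hmk)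
    have hnk : (0 : ℝ) < (n : ℝ) - k :=
      sub_pos.2 (by exact_mod_cast (show k < n by omega))
    have hnm : (0 : ℝ) < (n : ℝ) - m := by linarith
    rw [fdrift_of_le hS β₀ β₁ (by omega) hkθ (by omega),
      fdrift_of_le hS β₀ β₁ hm (by omega) (by omega)]
    generalize sqnorm2 (S.mulVec β₀) = A at *
    generalize sqnorm2 (S.mulVec β₁) = B at *
    generalize sqnorm2 (S.mulVec (β₁ - β₀)) = D at *
    have key : 0 ≤ ((n : ℝ) - θ) * ((k : ℝ) - m) / (((n : ℝ) - k) * ((n : ℝ) - m)) *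
        (((n : ℝ) - θ) * D / 2 + B - A) :=
      mul_nonneg (by positivity) (by linarith)
    rw [← sub_nonneg]
    convert key using 1
    field_simp
    ring
  · have hkm' : (0 : ℝ) ≤ (m : ℝ) - k := sub_nonneg.2 (by exact_mod_cast hkm)
    have hk0 : (0 : ℝ) < k := by exact_mod_cast (show 0 < k by omega)
    have hm0 : (0 : ℝ) < m := by linarith
    rw [fdrift_of_ge hS β₀ β₁ (by omega) hθk (by omega),
      fdrift_of_ge hS β₀ β₁ (by omega) (by omega) (by omega)]
    generalize sqnorm2 (S.mulVec β₀) = A at *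
    generalize sqnorm2 (S.mulVec β₁) = B at *
    generalize sqnorm2 (S.mulVec (β₁ - β₀)) = D at *
    have key : 0 ≤ (θ : ℝ) * ((m : ℝ) - k) / ((k : ℝ) * m) *
        ((θ : ℝ) * D / 2 + A - B) :=
      mul_nonneg (by positivity) (by linarith)
    rw [← sub_nonneg]
    convert key using 1
    field_simp
    ring
end
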